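/- Let Y be an ℝ^d-valued random variable with Rajchman law, Y_n = Y + (1/n)θ(nY) the rounding of Y to the nearest 1/n-graduation, and φ : ℝ^d → ℝ a C¹ Lipschitz function. Then for any ℝ^m-valued random variable X, (X, n(φ(Y_n) - φ(Y))) converges in distribution to (X, Σ_{i=1}^d V_i ∂_i φ(Y)) where V₁,...,V_d are i.i.d. uniform on (-1/2,1/2), independent of (X,Y). -/

import Mathlib

open MeasureTheory Filter

/-- Componentwise rounding error function: `θ(y)_i = 1/2 − {yᵢ}`. -/
noncomputable def roundTheta {d : ℕ} (y : Fin d → ℝ) : Fin d → ℝ :=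
  fun i => 1 / 2 - Int.fract (y i)

open scoped Topology NNReal

/-- A bounded sequence in a Hilbert space whose inner product with each of its own terms tends to
zero converges weakly to zero. -/
theorem tendsto_inner_zero_of_tendsto_inner_self {E : Type*} [NormedAddCommGroup E]
    [InnerProductSpace ℂ E] [CompleteSpace E] {e : ℕ → E} {C : ℝ≥0} (hC : ∀ n, ‖e n‖ ≤ C)
    (he : ∀ m, Tendsto (fun n => inner ℂ (e m) (e n)) atTop (𝓝 0)) (z : E) :
    Tendsto (fun n => inner ℂ z (e n)) atTop (𝓝 0) := by
  let S : Submodule ℂ E :=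
    { carrier := {z | Tendsto (fun n => inner ℂ z (e n)) atTop (𝓝 0)}
      zero_mem' := by simp
      add_mem' := fun {a b} ha hb => by
        simpa [inner_add_left] using Tendsto.add (Set.mem_ofPred.1 ha) (Set.mem_ofPred.1 hb)
      smul_mem' := fun c a ha => by
        simpa [inner_smul_left] using Tendsto.mul_const (starRingEnd ℂ c) (Set.mem_ofPred.1 ha) }
  have hclosed : IsClosed (S : Set E) := by
    refine Equicontinuous.isClosed_setOfPred_tendsto (f := fun _ => (0 : ℂ))
      (LipschitzWith.uniformEquicontinuous (fun n z => inner ℂ z (e n)) C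
        fun n => LipschitzWith.of_dist_le_mul fun x y => ?_).equicontinuous continuous_const
    rw [dist_eq_norm, dist_eq_norm, ← inner_sub_left, mul_comm]
    exact (norm_inner_le_norm _ _).trans (by gcongr; exact hC n)
  have := hclosed.completeSpace_coe
  have hbot : Sᗮ = ⊥ := by
    refine (Submodule.eq_bot_iff _).2 fun x hx => ?_
    have hxS : x ∈ S := by
      change Tendsto (fun n => inner ℂ x (e n)) atTop (𝓝 0)
      simp [fun n => (Submodule.mem_orthogonal' S x).1 hx (e n) (he n)]
    exact inner_self_eq_zero.1 ((Submodule.mem_orthogonal' S x).1 hx x hxS)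
  have hz : z ∈ S := by
    rw [Submodule.orthogonal_eq_bot_iff.1 hbot]
    trivial
  exact hz

/-- The class of `y` in the torus `(ℝ / ℤ)^d`. -/
noncomputable def torusMk {d : ℕ} (y : Fin d → ℝ) : UnitAddTorus (Fin d) :=
  fun i => (y i : UnitAddCircle)

/-- The class of `1/2 - v` in the torus `(ℝ / ℤ)^d`, for which `roundTheta` takes the value `v`. -/
noncomputable def torusOfError {d : ℕ} (v : Fin d → ℝ) : UnitAddTorus (Fin d) :=
  torusMk fun i => 1 / 2 - v i

/-- The uniform probability measure on the cube `(-1/2, 1/2)^d`. -/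
noncomputable def errorLaw (d : ℕ) : Measure (Fin d → ℝ) :=
  volume.restrict (Set.univ.pi fun _ : Fin d => Set.Ioo (-(1 / 2) : ℝ) (1 / 2))

theorem errorLaw_eq_pi (d : ℕ) :
    errorLaw d = Measure.pi fun _ => volume.restrict (Set.Ioo (-(1 / 2) : ℝ) (1 / 2)) := by
  rw [errorLaw, volume_pi, Measure.restrict_pi_pi]

instance (d : ℕ) : IsProbabilityMeasure (errorLaw d) := by
  have : IsProbabilityMeasure ((volume : Measure ℝ).restrict (Set.Ioo (-(1 / 2) : ℝ) (1 / 2))) :=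
    ⟨by rw [Measure.restrict_apply_univ, Real.volume_Ioo]; norm_num⟩
  rw [errorLaw_eq_pi]
  infer_instance

theorem continuous_torusMk {d : ℕ} : Continuous (torusMk (d := d)) :=
  continuous_pi fun i => (AddCircle.continuous_mk' 1).comp (by fun_prop)

theorem continuous_torusOfError {d : ℕ} : Continuous (torusOfError (d := d)) :=
  continuous_torusMk.comp (by fun_prop)

theorem integral_mFourier_torusOfError {d : ℕ} {k : Fin d → ℤ} (hk : k ≠ 0) :
    ∫ v, UnitAddTorus.mFourier k (torusOfError v) ∂errorLaw d = 0 := by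
  obtain ⟨i, hi⟩ := Function.ne_iff.1 hk
  rw [errorLaw_eq_pi]
  simp only [UnitAddTorus.mFourier, ContinuousMap.coe_mk, torusOfError, torusMk]
  rw [integral_fintype_prod_eq_prod
    (f := fun i (x : ℝ) => fourier (k i) ((1 / 2 - x : ℝ) : UnitAddCircle))]
  refine Finset.prod_eq_zero (Finset.mem_univ i) ?_
  have hc : (2 * Real.pi * Complex.I * (k i) : ℂ) ≠ 0 := by
    have : (k i : ℂ) ≠ 0 := by exact_mod_cast hi
    simp [Real.pi_ne_zero, this]
  rw [← integral_Ioc_eq_integral_Ioo, ← intervalIntegral.integral_of_le (by norm_num),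
    intervalIntegral.integral_comp_sub_left
      (f := fun x : ℝ => fourier (k i) (x : UnitAddCircle))]
  simp only [fourier_coe_apply, Complex.ofReal_one, div_one]
  rw [integral_exp_mul_complex hc]
  norm_num
  exact Or.inl (sub_eq_zero.2 (Complex.exp_eq_one_iff.2 ⟨k i, by ring⟩))

theorem mFourier_torusMk {d : ℕ} (k : Fin d → ℤ) (y : Fin d → ℝ) :
    UnitAddTorus.mFourier k (torusMk y) =
      Complex.exp (Complex.I * (∑ i, (2 * Real.pi * k i) * y i : ℝ)) := by
  simp only [UnitAddTorus.mFourier, ContinuousMap.coe_mk, torusMk, fourier_coe_apply]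
  rw [← Complex.exp_sum]
  congr 1
  push_cast
  rw [Finset.mul_sum]
  exact Finset.sum_congr rfl fun i _ => by ring

section Equidistribution

variable {Ω : Type*} [MeasurableSpace Ω] {P : Measure Ω} {d : ℕ} {Y : Ω → (Fin d → ℝ)}

theorem tendsto_setIntegral_mFourier [IsProbabilityMeasure P] (hY : Measurable Y)
    (hRaj : Tendsto (fun u : Fin d → ℝ =>
        ∫ ω, Complex.exp (Complex.I * (∑ i, u i * Y ω i)) ∂P)
      (cocompact (Fin d → ℝ)) (𝓝 0))
    {k : Fin d → ℤ} (hk : k ≠ 0) {A : Set Ω} (hA : MeasurableSet A) :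
    Tendsto (fun n : ℕ => ∫ ω in A, UnitAddTorus.mFourier k (torusMk ((n : ℝ) • Y ω)) ∂P)
      atTop (𝓝 0) := by
  let f : ℕ → Ω → ℂ := fun n ω => UnitAddTorus.mFourier k (torusMk ((n : ℝ) • Y ω))
  have hfm : ∀ n, AEStronglyMeasurable (f n) P := fun n =>
    (((UnitAddTorus.mFourier k).continuous.comp continuous_torusMk).measurable.comp
      (hY.const_smul (n : ℝ))).aestronglyMeasurable
  have hfb : ∀ n ω, ‖f n ω‖ ≤ 1 := fun n ω =>
    ((UnitAddTorus.mFourier k).norm_coe_le_norm _).trans UnitAddTorus.mFourier_norm.le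
  have hfL : ∀ n, MemLp (f n) 2 P := fun n =>
    MemLp.of_bound (hfm n) 1 (Eventually.of_forall (hfb n))
  have hcoe : ∀ n, (hfL n).toLp (f n) =ᵐ[P] f n := fun n => (hfL n).coeFn_toLp
  have hbound : ∀ n, ‖(hfL n).toLp (f n)‖ ≤ (1 : ℝ≥0) := fun n => by
    have := Lp.norm_le_of_ae_bound (f := (hfL n).toLp (f n)) (C := 1) zero_le_one
      ((hcoe n).mono fun ω h => by rw [h]; exact hfb n ω)
    simpa [measureUnivNNReal] using this
  have hinner : ∀ m, Tendsto
      (fun n => inner ℂ ((hfL m).toLp (f m)) ((hfL n).toLp (f n))) atTop (𝓝 0) := fun m => by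
    let w : Fin d → ℝ := fun i => 2 * Real.pi * k i
    have hw : 0 < ‖w‖ := by
      obtain ⟨i, hi⟩ := Function.ne_iff.1 hk
      refine norm_pos_iff.2 (Function.ne_iff.2 ⟨i, ?_⟩)
      have : (k i : ℝ) ≠ 0 := by exact_mod_cast hi
      simp [w, Real.pi_ne_zero, this]
    have hcoc : Tendsto (fun n : ℕ => ((n : ℝ) - m) • w) atTop (cocompact (Fin d → ℝ)) := by
      rw [← Metric.cobounded_eq_cocompact, ← tendsto_norm_atTop_iff_cobounded]
      simp_rw [norm_smul]
      refine Tendsto.atTop_mul_const hw (tendsto_norm_atTop_atTop.comp ?_)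
      exact tendsto_atTop_add_const_right _ _ tendsto_natCast_atTop_atTop
    refine (hRaj.comp hcoc).congr fun n => ?_
    rw [L2.inner_def]
    refine integral_congr_ae ?_
    filter_upwards [hcoe m, hcoe n] with ω hm hn
    rw [hm, hn]
    simp only [f, RCLike.inner_apply]
    rw [← UnitAddTorus.mFourier_neg, mFourier_torusMk, mFourier_torusMk, ← Complex.exp_add]
    simp only [w]
    congr 1
    push_cast
    rw [← mul_add, ← Finset.sum_add_distrib]
    congr 1
    refine Finset.sum_congr rfl fun i _ => ?_
    simp only [Pi.smul_apply, Pi.neg_apply, smul_eq_mul]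
    push_cast
    ring
  refine (tendsto_inner_zero_of_tendsto_inner_self hbound hinner
    (indicatorConstLp 2 hA (measure_ne_top P A) 1)).congr fun n => ?_
  rw [L2.inner_indicatorConstLp_one]
  exact integral_congr_ae (ae_restrict_of_ae (hcoe n))

theorem integrable_comp_torusOfError (c : C(UnitAddTorus (Fin d), ℂ)) :
    Integrable (fun v => c (torusOfError v)) (errorLaw d) :=
  Integrable.of_bound (c.continuous.comp continuous_torusOfError).aestronglyMeasurable ‖c‖
    (Eventually.of_forall fun _ => c.norm_coe_le_norm _)

theorem lipschitzWith_integral_torusOfError :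
    LipschitzWith 1 fun c : C(UnitAddTorus (Fin d), ℂ) =>
      ∫ v, c (torusOfError v) ∂errorLaw d := by
  refine LipschitzWith.of_dist_le_mul fun a b => ?_
  rw [dist_eq_norm, ← integral_sub (integrable_comp_torusOfError a)
    (integrable_comp_torusOfError b), NNReal.coe_one, one_mul, dist_eq_norm]
  refine (norm_integral_le_of_norm_le_const (C := ‖a - b‖)
    (Eventually.of_forall fun v => (a - b).norm_coe_le_norm _)).trans ?_
  simp

theorem integrable_apply_torusMk (hY : Measurable Y) {G : Ω → C(UnitAddTorus (Fin d), ℂ)}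
    (hG : Integrable G P) (n : ℕ) :
    Integrable (fun ω => G ω (torusMk ((n : ℝ) • Y ω))) P := by
  refine hG.norm.mono' ?_ (Eventually.of_forall fun ω => (G ω).norm_coe_le_norm _)
  have ht : AEStronglyMeasurable (fun ω => torusMk ((n : ℝ) • Y ω)) P :=
    (continuous_torusMk.measurable.comp (hY.const_smul (n : ℝ))).aestronglyMeasurable
  exact continuous_eval.comp_aestronglyMeasurable (hG.aestronglyMeasurable.prodMk ht)

theorem tendsto_setIntegral_torusMk [IsProbabilityMeasure P] (hY : Measurable Y)
    (hRaj : Tendsto (fun u : Fin d → ℝ =>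
        ∫ ω, Complex.exp (Complex.I * (∑ i, u i * Y ω i)) ∂P)
      (cocompact (Fin d → ℝ)) (𝓝 0))
    {A : Set Ω} (hA : MeasurableSet A) (c : C(UnitAddTorus (Fin d), ℂ)) :
    Tendsto (fun n : ℕ => ∫ ω in A, c (torusMk ((n : ℝ) • Y ω)) ∂P)
      atTop (𝓝 (∫ _ in A, (∫ v, c (torusOfError v) ∂errorLaw d) ∂P)) := by
  have hint : ∀ (c : C(UnitAddTorus (Fin d), ℂ)) (n : ℕ),
      Integrable (fun ω => c (torusMk ((n : ℝ) • Y ω))) (P.restrict A) := fun c n =>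
    (integrable_apply_torusMk hY (integrable_const c) n).restrict
  let S : Submodule ℂ C(UnitAddTorus (Fin d), ℂ) :=
    { carrier := {c | Tendsto (fun n : ℕ => ∫ ω in A, c (torusMk ((n : ℝ) • Y ω)) ∂P)
        atTop (𝓝 (∫ _ in A, (∫ v, c (torusOfError v) ∂errorLaw d) ∂P))}
      zero_mem' := by simp
      add_mem' := fun {a b} ha hb => by
        refine Set.mem_ofPred.2 ?_
        simp only [ContinuousMap.add_apply, integral_add (hint a _) (hint b _),
          integral_add (integrable_comp_torusOfError a) (integrable_comp_torusOfError b),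
          integral_add (integrable_const _) (integrable_const _)]
        exact Tendsto.add (Set.mem_ofPred.1 ha) (Set.mem_ofPred.1 hb)
      smul_mem' := fun r a ha => by
        refine Set.mem_ofPred.2 ?_
        simp only [ContinuousMap.smul_apply, integral_smul]
        exact Tendsto.const_smul (Set.mem_ofPred.1 ha) r }
  have hclosed : IsClosed (S : Set C(UnitAddTorus (Fin d), ℂ)) := by
    refine Equicontinuous.isClosed_setOfPred_tendsto
      (F := fun (n : ℕ) (c : C(UnitAddTorus (Fin d), ℂ)) =>
        ∫ ω in A, c (torusMk ((n : ℝ) • Y ω)) ∂P)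
      (f := fun c : C(UnitAddTorus (Fin d), ℂ) =>
        ∫ _ in A, (∫ v, c (torusOfError v) ∂errorLaw d) ∂P)
      (LipschitzWith.uniformEquicontinuous _ 1
        fun n => LipschitzWith.of_dist_le_mul fun a b => ?_).equicontinuous ?_
    · rw [dist_eq_norm, ← integral_sub (hint a n) (hint b n), NNReal.coe_one, one_mul, dist_eq_norm]
      refine (norm_setIntegral_le_of_norm_le_const (C := ‖a - b‖) (measure_lt_top P A)
        fun ω _ => (a - b).norm_coe_le_norm _).trans ?_
      exact mul_le_of_le_one_right (norm_nonneg _) measureReal_le_one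
    · simp only [integral_const]
      exact lipschitzWith_integral_torusOfError.continuous.const_smul _
  have hle : Submodule.span ℂ (Set.range (UnitAddTorus.mFourier (d := Fin d))) ≤ S := by
    refine Submodule.span_le.2 ?_
    rintro _ ⟨k, rfl⟩
    change Tendsto _ _ _
    rcases eq_or_ne k 0 with rfl | hk
    · simp [UnitAddTorus.mFourier_zero]
    · simpa [integral_mFourier_torusOfError hk] using tendsto_setIntegral_mFourier hY hRaj hk hA
  have hc : c ∈ (Submodule.span ℂ
      (Set.range (UnitAddTorus.mFourier (d := Fin d)))).topologicalClosure := by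
    rw [UnitAddTorus.span_mFourier_closure_eq_top]
    trivial
  exact Submodule.topologicalClosure_minimal _ hle hclosed hc

theorem tendsto_integral_apply_torusMk [IsProbabilityMeasure P] (hY : Measurable Y)
    (hRaj : Tendsto (fun u : Fin d → ℝ =>
        ∫ ω, Complex.exp (Complex.I * (∑ i, u i * Y ω i)) ∂P)
      (cocompact (Fin d → ℝ)) (𝓝 0))
    {G : Ω → C(UnitAddTorus (Fin d), ℂ)} (hG : Integrable G P) :
    Tendsto (fun n : ℕ => ∫ ω, G ω (torusMk ((n : ℝ) • Y ω)) ∂P)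
      atTop (𝓝 (∫ ω, (∫ v, G ω (torusOfError v) ∂errorLaw d) ∂P)) := by
  have hint : ∀ {G : Ω → C(UnitAddTorus (Fin d), ℂ)}, Integrable G P →
      Integrable (fun ω => ∫ v, G ω (torusOfError v) ∂errorLaw d) P := fun {G} hG => by
    refine hG.norm.mono' (lipschitzWith_integral_torusOfError.continuous.comp_aestronglyMeasurable
      hG.aestronglyMeasurable) (Eventually.of_forall fun ω => ?_)
    simpa using norm_integral_le_of_norm_le_const (μ := errorLaw d) (C := ‖G ω‖)
      (Eventually.of_forall fun v => (G ω).norm_coe_le_norm (torusOfError v))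
  refine Integrable.induction (fun G : Ω → C(UnitAddTorus (Fin d), ℂ) =>
    Tendsto (fun n : ℕ => ∫ ω, G ω (torusMk ((n : ℝ) • Y ω)) ∂P)
      atTop (𝓝 (∫ ω, (∫ v, G ω (torusOfError v) ∂errorLaw d) ∂P))) ?_ ?_ ?_ ?_ hG
  · intro c s hs _
    have h1 : ∀ n : ℕ, ∫ ω, (s.indicator (fun _ => c) ω) (torusMk ((n : ℝ) • Y ω)) ∂P =
        ∫ ω in s, c (torusMk ((n : ℝ) • Y ω)) ∂P := fun n => by
      rw [← integral_indicator hs]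
      congr 1 with ω
      by_cases h : ω ∈ s <;> simp [h]
    have h2 : ∫ ω, (∫ v, (s.indicator (fun _ => c) ω) (torusOfError v) ∂errorLaw d) ∂P =
        ∫ _ in s, (∫ v, c (torusOfError v) ∂errorLaw d) ∂P := by
      rw [← integral_indicator hs]
      congr 1 with ω
      by_cases h : ω ∈ s <;> simp [h]
    simp only [h1, h2]
    exact tendsto_setIntegral_torusMk hY hRaj hs c
  · intro f g _ hf hg hf' hg'
    simp only [Pi.add_apply, ContinuousMap.add_apply,
      integral_add (integrable_apply_torusMk hY hf _) (integrable_apply_torusMk hY hg _),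
      integral_add (integrable_comp_torusOfError _) (integrable_comp_torusOfError _),
      integral_add (hint hf) (hint hg)]
    exact hf'.add hg'
  · refine Equicontinuous.isClosed_setOfPred_tendsto
      (F := fun (n : ℕ) (f : Ω →₁[P] C(UnitAddTorus (Fin d), ℂ)) =>
        ∫ ω, f ω (torusMk ((n : ℝ) • Y ω)) ∂P)
      (f := fun f : Ω →₁[P] C(UnitAddTorus (Fin d), ℂ) =>
        ∫ ω, (∫ v, f ω (torusOfError v) ∂errorLaw d) ∂P)
      (LipschitzWith.uniformEquicontinuous _ 1
        fun n => LipschitzWith.of_dist_le_mul fun a b => ?_).equicontinuous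
      (LipschitzWith.of_dist_le_mul (K := 1) fun a b => ?_).continuous
    · rw [dist_eq_norm, ← integral_sub (integrable_apply_torusMk hY (L1.integrable_coeFn a) n)
        (integrable_apply_torusMk hY (L1.integrable_coeFn b) n), NNReal.coe_one, one_mul,
        dist_eq_norm, L1.norm_eq_integral_norm]
      refine norm_integral_le_of_norm_le (L1.integrable_coeFn (a - b)).norm ?_
      filter_upwards [Lp.coeFn_sub a b] with ω h
      rw [h]
      exact (a ω - b ω).norm_coe_le_norm _
    · rw [dist_eq_norm, ← integral_sub (hint (L1.integrable_coeFn a))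
        (hint (L1.integrable_coeFn b)), NNReal.coe_one, one_mul,
        dist_eq_norm, L1.norm_eq_integral_norm]
      refine norm_integral_le_of_norm_le (L1.integrable_coeFn (a - b)).norm ?_
      filter_upwards [Lp.coeFn_sub a b] with ω h
      rw [h, ← dist_eq_norm]
      simpa [dist_eq_norm] using lipschitzWith_integral_torusOfError.dist_le_mul (a ω) (b ω)
  · intro f g h _ hf
    have h2 : ∫ ω, (∫ v, f ω (torusOfError v) ∂errorLaw d) ∂P =
        ∫ ω, (∫ v, g ω (torusOfError v) ∂errorLaw d) ∂P :=
      integral_congr_ae (h.mono fun ω e => by simp only [e])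
    rw [h2] at hf
    exact hf.congr fun n => integral_congr_ae (h.mono fun ω e => by simp only [e])

/-- Along a Rajchman variable `Y`, the classes of `n Y` modulo `1` converge in law to the uniform
distribution on the torus, stably with respect to any other variable `W`. -/
theorem tendsto_integral_comp_torusMk [IsProbabilityMeasure P] (hY : Measurable Y)
    (hRaj : Tendsto (fun u : Fin d → ℝ =>
        ∫ ω, Complex.exp (Complex.I * (∑ i, u i * Y ω i)) ∂P)
      (cocompact (Fin d → ℝ)) (𝓝 0))
    {E : Type*} [TopologicalSpace E] [TopologicalSpace.PseudoMetrizableSpace E]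
    [SecondCountableTopology E] [MeasurableSpace E] [OpensMeasurableSpace E]
    {W : Ω → E} (hW : Measurable W) {g : E × UnitAddTorus (Fin d) → ℝ} (hg : Continuous g)
    {M : ℝ} (hM : ∀ p, |g p| ≤ M) :
    Tendsto (fun n : ℕ => ∫ ω, g (W ω, torusMk ((n : ℝ) • Y ω)) ∂P)
      atTop (𝓝 (∫ ω, (∫ v, g (W ω, torusOfError v) ∂errorLaw d) ∂P)) := by
  let Γ : C(E, C(UnitAddTorus (Fin d), ℂ)) :=
    ContinuousMap.curry ⟨fun p => (g p : ℂ), Complex.continuous_ofReal.comp hg⟩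
  have hΓ : Integrable (fun ω => Γ (W ω)) P := by
    refine Integrable.of_bound (Γ.continuous.comp_stronglyMeasurable
      hW.stronglyMeasurable).aestronglyMeasurable M (Eventually.of_forall fun ω => ?_)
    refine (ContinuousMap.norm_le _ ((abs_nonneg _).trans (hM (W ω, 0)))).2 fun t => ?_
    simpa [Γ] using hM (W ω, t)
  have key := tendsto_integral_apply_torusMk hY hRaj hΓ
  simp only [Γ, ContinuousMap.curry_apply, ContinuousMap.coe_mk, integral_complex_ofReal] at key
  exact tendsto_ofReal_iff.1 key

end Equidistribution

section Sawtooth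

/-- A continuous function on the circle which agrees with the discontinuous map
`y ↦ 1/2 - {y}` away from a neighbourhood of `0` of size of order `1 / k`. -/
noncomputable def circleSawtooth (k : ℕ) : UnitAddCircle → ℝ :=
  AddCircle.liftIco 1 0 fun u => (1 / 2 - u) * min 1 (k * (u * (1 - u)))

/-- A continuous function on the circle with values in `[0, 2]`, at least `1` where
`circleSawtooth k` differs from `1/2 - {y}`. -/
noncomputable def circleBump (k : ℕ) : UnitAddCircle → ℝ :=
  AddCircle.liftIco 1 0 fun u => max 0 (2 - k * (u * (1 - u)))

theorem continuous_circleSawtooth (k : ℕ) : Continuous (circleSawtooth k) :=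
  AddCircle.liftIco_zero_continuous (by simp) (by fun_prop)

theorem continuous_circleBump (k : ℕ) : Continuous (circleBump k) :=
  AddCircle.liftIco_zero_continuous (by simp) (by fun_prop)

theorem liftIco_coe_eq_fract (f : ℝ → ℝ) (y : ℝ) :
    AddCircle.liftIco 1 0 f (y : UnitAddCircle) = f (Int.fract y) := by
  simp [AddCircle.liftIco, AddCircle.coe_equivIco_mk_apply]

theorem circleBump_nonneg (k : ℕ) (t : UnitAddCircle) : 0 ≤ circleBump k t :=
  le_max_left _ _

theorem circleBump_le_two (k : ℕ) (t : UnitAddCircle) : circleBump k t ≤ 2 := by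
  induction t using QuotientAddGroup.induction_on with
  | H y =>
    rw [circleBump, liftIco_coe_eq_fract]
    have h0 := Int.fract_nonneg y
    have h1 := (Int.fract_lt_one y).le
    have : 0 ≤ (k : ℝ) * (Int.fract y * (1 - Int.fract y)) :=
      mul_nonneg k.cast_nonneg (mul_nonneg h0 (sub_nonneg.2 h1))
    exact max_le zero_le_two (by linarith)

theorem circleSawtooth_eq_or_one_le_circleBump (k : ℕ) (y : ℝ) :
    circleSawtooth k y = 1 / 2 - Int.fract y ∨ 1 ≤ circleBump k y := by
  rw [circleSawtooth, circleBump, liftIco_coe_eq_fract, liftIco_coe_eq_fract]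
  rcases le_total 1 (k * (Int.fract y * (1 - Int.fract y))) with h | h
  · exact Or.inl (by rw [min_eq_left h, mul_one])
  · exact Or.inr (le_max_of_le_right (by linarith))

theorem tendsto_circleBump {y : ℝ} (hy : Int.fract y ≠ 0) :
    Tendsto (fun k : ℕ => circleBump k y) atTop (𝓝 0) := by
  have h0 := lt_of_le_of_ne (Int.fract_nonneg y) hy.symm
  have h1 := Int.fract_lt_one y
  have hpos : 0 < Int.fract y * (1 - Int.fract y) := mul_pos h0 (sub_pos.2 h1)
  refine tendsto_const_nhds.congr' ?_
  filter_upwards [(tendsto_natCast_atTop_atTop.atTop_mul_const hpos).eventually_ge_atTop 2]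
    with k hk
  rw [circleBump, liftIco_coe_eq_fract, max_eq_left (by linarith)]

variable {d : ℕ}

theorem measurable_roundTheta : Measurable (roundTheta (d := d)) :=
  measurable_pi_lambda _ fun i => (measurable_fract.comp (measurable_pi_apply i)).const_sub _

theorem ae_errorLaw_mem_Ioo : ∀ᵐ v ∂errorLaw d, ∀ i, v i ∈ Set.Ioo (-(1 / 2) : ℝ) (1 / 2) := by
  filter_upwards [ae_restrict_mem (MeasurableSet.univ_pi fun _ => measurableSet_Ioo)] with v hv i
  exact hv i trivial

theorem fract_half_sub {x : ℝ} (hx : x ∈ Set.Ioo (-(1 / 2) : ℝ) (1 / 2)) :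
    Int.fract (1 / 2 - x) = 1 / 2 - x :=
  Int.fract_eq_self.2 ⟨by linarith [hx.2], by linarith [hx.1]⟩

theorem ae_errorLaw_roundTheta :
    ∀ᵐ v ∂errorLaw d, roundTheta (fun i => 1 / 2 - v i) = v := by
  filter_upwards [ae_errorLaw_mem_Ioo] with v hv
  ext i
  rw [roundTheta, fract_half_sub (hv i)]
  ring

theorem tendsto_integral_sum_circleBump (M : ℝ) :
    Tendsto (fun k : ℕ => ∫ v, M * ∑ i, circleBump k (torusOfError v i) ∂errorLaw d)
      atTop (𝓝 0) := by
  have hlim : Tendsto (fun k : ℕ => ∫ v, ∑ i, circleBump k (torusOfError v i) ∂errorLaw d)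
      atTop (𝓝 (∫ _, 0 ∂errorLaw d)) := by
    refine tendsto_integral_of_dominated_convergence (fun _ => ∑ _ : Fin d, 2)
      (fun k => ?_) (integrable_const _) (fun k => Eventually.of_forall fun v => ?_) ?_
    · exact (continuous_finsetSum _ fun i _ => (continuous_circleBump k).comp
        ((continuous_apply i).comp continuous_torusOfError)).aestronglyMeasurable
    · rw [Real.norm_of_nonneg (Finset.sum_nonneg fun i _ => circleBump_nonneg k _)]
      exact Finset.sum_le_sum fun i _ => circleBump_le_two k _
    · filter_upwards [ae_errorLaw_mem_Ioo] with v hv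
      rw [← Finset.sum_const_zero (s := (Finset.univ : Finset (Fin d)))]
      refine tendsto_finsetSum _ fun i _ => tendsto_circleBump ?_
      rw [fract_half_sub (hv i)]
      linarith [(hv i).2]
  simpa [integral_const_mul] using hlim.const_mul M

theorem abs_sub_circleSawtooth_le {h : (Fin d → ℝ) → ℝ} {M : ℝ} (hM : ∀ v, |h v| ≤ M) (k : ℕ)
    (y : Fin d → ℝ) :
    |h (roundTheta y) - h fun i => circleSawtooth k (torusMk y i)| ≤
      2 * M * ∑ i, circleBump k (torusMk y i) := by
  have hM0 : 0 ≤ M := (abs_nonneg _).trans (hM 0)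
  by_cases hex : ∃ i, 1 ≤ circleBump k (torusMk y i)
  · obtain ⟨i, hi⟩ := hex
    have hsum : 1 ≤ ∑ i, circleBump k (torusMk y i) :=
      hi.trans (Finset.single_le_sum (f := fun i => circleBump k (torusMk y i))
        (fun j _ => circleBump_nonneg k _) (Finset.mem_univ i))
    calc _ ≤ |h (roundTheta y)| + |h fun i => circleSawtooth k (torusMk y i)| := abs_sub _ _
      _ ≤ 2 * M := by linarith [hM (roundTheta y), hM fun i => circleSawtooth k (torusMk y i)]
      _ ≤ _ := le_mul_of_one_le_right (by positivity) hsum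
  · have heq : roundTheta y = fun i => circleSawtooth k (torusMk y i) := by
      ext i
      exact ((circleSawtooth_eq_or_one_le_circleBump k (y i)).resolve_right
        fun hi => hex ⟨i, hi⟩).symm
    rw [heq, sub_self, abs_zero]
    exact mul_nonneg (by positivity) (Finset.sum_nonneg fun i _ => circleBump_nonneg k _)

variable {Ω : Type*} [MeasurableSpace Ω] {P : Measure Ω} [IsProbabilityMeasure P]
  {Y : Ω → (Fin d → ℝ)}

/-- The rounding errors `roundTheta (n Y)` of a Rajchman variable `Y` converge in law to the uniform
distribution on the cube, stably with respect to any other variable `W`. -/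
theorem tendsto_integral_comp_roundTheta (hY : Measurable Y)
    (hRaj : Tendsto (fun u : Fin d → ℝ =>
        ∫ ω, Complex.exp (Complex.I * (∑ i, u i * Y ω i)) ∂P)
      (cocompact (Fin d → ℝ)) (𝓝 0))
    {E : Type*} [TopologicalSpace E] [TopologicalSpace.PseudoMetrizableSpace E]
    [SecondCountableTopology E] [MeasurableSpace E] [OpensMeasurableSpace E]
    {W : Ω → E} (hW : Measurable W) {h : E × (Fin d → ℝ) → ℝ} (hh : Continuous h)
    {M : ℝ} (hM : ∀ p, |h p| ≤ M) :
    Tendsto (fun n : ℕ => ∫ ω, h (W ω, roundTheta ((n : ℝ) • Y ω)) ∂P)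
      atTop (𝓝 (∫ ω, (∫ v, h (W ω, v) ∂errorLaw d) ∂P)) := by
  let g : ℕ → E × UnitAddTorus (Fin d) → ℝ := fun k p => h (p.1, fun i => circleSawtooth k (p.2 i))
  let B : ℕ → UnitAddTorus (Fin d) → ℝ := fun k t => 2 * M * ∑ i, circleBump k (t i)
  have hgc : ∀ k, Continuous (g k) := fun k =>
    hh.comp (continuous_fst.prodMk (continuous_pi fun i =>
      (continuous_circleSawtooth k).comp ((continuous_apply i).comp continuous_snd)))
  have hBc : ∀ k, Continuous (B k) := fun k =>
    continuous_const.mul (continuous_finsetSum _ fun i _ =>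
      (continuous_circleBump k).comp (continuous_apply i))
  have hBb : ∀ k, ∃ C, ∀ t, |B k t| ≤ C := fun k => by
    obtain ⟨C, hC⟩ := isCompact_univ.exists_bound_of_continuousOn (hBc k).continuousOn
    exact ⟨C, fun t => hC t trivial⟩
  have hcmp : ∀ k w y, |h (w, roundTheta y) - g k (w, torusMk y)| ≤ B k (torusMk y) :=
    fun k w y => abs_sub_circleSawtooth_le (h := fun v => h (w, v)) (fun v => hM _) k y
  have htm : ∀ n : ℕ, Measurable fun ω => torusMk ((n : ℝ) • Y ω) := fun n =>
    continuous_torusMk.measurable.comp (hY.const_smul (n : ℝ))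
  have hmain : ∀ k n : ℕ, |∫ ω, h (W ω, roundTheta ((n : ℝ) • Y ω)) ∂P -
      ∫ ω, (∫ v, h (W ω, v) ∂errorLaw d) ∂P| ≤
      ∫ ω, B k (torusMk ((n : ℝ) • Y ω)) ∂P +
      |∫ ω, g k (W ω, torusMk ((n : ℝ) • Y ω)) ∂P -
        ∫ ω, (∫ v, g k (W ω, torusOfError v) ∂errorLaw d) ∂P| +
      ∫ v, B k (torusOfError v) ∂errorLaw d := fun k n => by
    obtain ⟨C, hC⟩ := hBb k
    have hfst : |∫ ω, h (W ω, roundTheta ((n : ℝ) • Y ω)) ∂P -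
        ∫ ω, g k (W ω, torusMk ((n : ℝ) • Y ω)) ∂P| ≤
        ∫ ω, B k (torusMk ((n : ℝ) • Y ω)) ∂P := by
      rw [← integral_sub, ← Real.norm_eq_abs]
      · have hB : Integrable (fun ω => B k (torusMk ((n : ℝ) • Y ω))) P :=
          Integrable.of_bound ((hBc k).measurable.comp (htm n)).aestronglyMeasurable C
            (Eventually.of_forall fun ω => hC _)
        refine norm_integral_le_of_norm_le hB (Eventually.of_forall fun ω => ?_)
        exact hcmp k (W ω) _
      · exact Integrable.of_bound (hh.measurable.comp (hW.prodMk (measurable_roundTheta.comp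
          (hY.const_smul (n : ℝ))))).aestronglyMeasurable M (Eventually.of_forall fun ω => hM _)
      · exact Integrable.of_bound ((hgc k).measurable.comp
          (hW.prodMk (htm n))).aestronglyMeasurable M (Eventually.of_forall fun ω => hM _)
    have hlst : |∫ ω, (∫ v, g k (W ω, torusOfError v) ∂errorLaw d) ∂P -
        ∫ ω, (∫ v, h (W ω, v) ∂errorLaw d) ∂P| ≤ ∫ v, B k (torusOfError v) ∂errorLaw d := by
      have hint : ∀ f : E × (Fin d → ℝ) → ℝ, Continuous f → (∀ p, |f p| ≤ M) →
          Integrable (fun ω => ∫ v, f (W ω, v) ∂errorLaw d) P := fun f hf hfM => by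
        refine Integrable.of_bound (StronglyMeasurable.integral_prod_right'
          (f := fun p : Ω × (Fin d → ℝ) => f (W p.1, p.2)) (hf.measurable.comp
            ((hW.comp measurable_fst).prodMk measurable_snd)).stronglyMeasurable
          ).aestronglyMeasurable M (Eventually.of_forall fun ω => ?_)
        simpa using norm_integral_le_of_norm_le_const (μ := errorLaw d)
          (f := fun v => f (W ω, v)) (Eventually.of_forall fun v => hfM (W ω, v))
      have hgo : Continuous fun p : E × (Fin d → ℝ) => g k (p.1, torusOfError p.2) :=
        (hgc k).comp (continuous_fst.prodMk (continuous_torusOfError.comp continuous_snd))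
      rw [← integral_sub (hint _ hgo fun _ => hM _) (hint h hh hM)]
      have hpt : ∀ ω, ‖∫ v, g k (W ω, torusOfError v) ∂errorLaw d -
          ∫ v, h (W ω, v) ∂errorLaw d‖ ≤ ∫ v, B k (torusOfError v) ∂errorLaw d := fun ω => by
        rw [← integral_sub]
        · refine norm_integral_le_of_norm_le
            (Integrable.of_bound ((hBc k).comp continuous_torusOfError).aestronglyMeasurable C
              (Eventually.of_forall fun v => hC _)) ?_
          filter_upwards [ae_errorLaw_roundTheta] with v hv
          have := hcmp k (W ω) fun i => 1 / 2 - v i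
          rw [hv, abs_sub_comm] at this
          exact this
        · exact Integrable.of_bound (hgo.comp (continuous_const.prodMk
            continuous_id)).aestronglyMeasurable M (Eventually.of_forall fun v => hM _)
        · exact Integrable.of_bound (hh.comp (continuous_const.prodMk
            continuous_id)).aestronglyMeasurable M (Eventually.of_forall fun v => hM _)
      simpa using norm_integral_le_of_norm_le_const (μ := P) (Eventually.of_forall hpt)
    refine (abs_sub_le _ (∫ ω, g k (W ω, torusMk ((n : ℝ) • Y ω)) ∂P) _).trans ?_
    rw [add_assoc]
    refine add_le_add hfst ((abs_sub_le _
      (∫ ω, (∫ v, g k (W ω, torusOfError v) ∂errorLaw d) ∂P) _).trans ?_)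
    exact add_le_add le_rfl hlst
  rw [Metric.tendsto_atTop']
  intro ε hε
  obtain ⟨k, hk⟩ := ((tendsto_integral_sum_circleBump (d := d) (2 * M)).eventually_lt_const
    (half_pos hε)).exists
  obtain ⟨C, hC⟩ := hBb k
  have hlimB := tendsto_integral_comp_torusMk hY hRaj hW (g := fun p => B k p.2)
    ((hBc k).comp continuous_snd) (fun p => hC p.2)
  have hlimg := tendsto_integral_comp_torusMk hY hRaj hW (hgc k) (fun p => hM _)
  have hlim := (hlimB.add (tendsto_sub_nhds_zero_iff.2 hlimg).abs).add_const
    (∫ v, B k (torusOfError v) ∂errorLaw d)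
  have hsmall : ∫ _, (∫ v, B k (torusOfError v) ∂errorLaw d) ∂P + |0| +
      ∫ v, B k (torusOfError v) ∂errorLaw d < ε := by
    simp only [integral_const, probReal_univ, one_smul, abs_zero]
    change ∫ v, B k (torusOfError v) ∂errorLaw d < ε / 2 at hk
    linarith
  obtain ⟨N, hN⟩ := eventually_atTop.1 (hlim.eventually_lt_const hsmall)
  exact ⟨N, fun n hn => (hmain k n).trans_lt (hN n hn.le)⟩

end Sawtooth

lemma tendsto_sub_comp_of_tendsto_sub {g : ℝ → ℝ} (hg : Continuous g) {a b : ℕ → ℝ} {R : ℝ}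
    (hb : ∀ n, |b n| ≤ R) (hab : Tendsto (fun n => a n - b n) atTop (𝓝 0)) :
    Tendsto (fun n => g (a n) - g (b n)) atTop (𝓝 0) := by
  have hu : UniformContinuousOn g (Metric.closedBall 0 (R + 1)) :=
    (isCompact_closedBall 0 (R + 1)).uniformContinuousOn_of_continuous hg.continuousOn
  rw [Metric.uniformContinuousOn_iff] at hu
  rw [Metric.tendsto_atTop] at hab ⊢
  intro ε hε
  obtain ⟨δ, hδ, hu⟩ := hu ε hε
  obtain ⟨N, hN⟩ := hab (min δ 1) (lt_min hδ one_pos)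
  refine ⟨N, fun n hn => ?_⟩
  have hn := hN n hn
  rw [dist_zero_right, Real.norm_eq_abs, lt_min_iff] at hn
  rw [dist_zero_right, ← dist_eq_norm]
  have hbn := hb n
  have := abs_sub_abs_le_abs_sub (a n) (b n)
  refine hu _ ?_ _ ?_ ?_
  · rw [mem_closedBall_zero_iff, Real.norm_eq_abs]
    linarith [hn.2]
  · rw [mem_closedBall_zero_iff, Real.norm_eq_abs]
    linarith
  · rw [Real.dist_eq]
    exact hn.1

lemma norm_roundTheta_le_one {d : ℕ} (y : Fin d → ℝ) : ‖roundTheta y‖ ≤ 1 := by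
  refine (pi_norm_le_iff_of_nonneg zero_le_one).2 fun i => ?_
  have h0 := Int.fract_nonneg (y i)
  have h1 := Int.fract_lt_one (y i)
  rw [Real.norm_eq_abs, roundTheta, abs_le]
  constructor <;> linarith

lemma HasFDerivAt.tendsto_nat_mul_sub_sub {E : Type*} [NormedAddCommGroup E] [NormedSpace ℝ E]
    {φ : E → ℝ} {L : E →L[ℝ] ℝ} {y : E} (hφ : HasFDerivAt φ L y) {w : ℕ → E}
    {R : ℝ} (hw : ∀ n, ‖w n‖ ≤ R) :
    Tendsto (fun n : ℕ => (n : ℝ) * (φ (y + (1 / (n : ℝ)) • w n) - φ y) - L (w n))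
      atTop (𝓝 0) := by
  have hR : 0 ≤ R := (norm_nonneg _).trans (hw 0)
  have hsmall : Tendsto (fun n : ℕ => (1 / (n : ℝ)) • w n) atTop (𝓝 0) := by
    refine squeeze_zero_norm (a := fun n : ℕ => 1 / (n : ℝ) * R) (fun n => ?_) ?_
    · rw [norm_smul, Real.norm_of_nonneg (by positivity)]
      gcongr
      exact hw n
    · simpa using tendsto_one_div_atTop_nhds_zero_nat.mul_const R
  have ho := (hasFDerivAt_iff_isLittleO_nhds_zero.1 hφ).comp_tendsto hsmall
  rw [Metric.tendsto_atTop]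
  intro ε hε
  have hc : 0 < ε / (R + 1) := by positivity
  obtain ⟨N, hN⟩ := eventually_atTop.1 ((Asymptotics.isLittleO_iff.1 ho hc))
  refine ⟨max N 1, fun n hn => ?_⟩
  have hn0 : (0 : ℝ) < n := by
    exact_mod_cast (le_max_right N 1).trans hn
  have h := hN n ((le_max_left N 1).trans hn)
  simp only [Function.comp_apply, map_smul, smul_eq_mul] at h
  rw [norm_smul, Real.norm_of_nonneg (show 0 ≤ 1 / (n : ℝ) by positivity)] at h
  have heq : (n : ℝ) * (φ (y + (1 / (n : ℝ)) • w n) - φ y) - L (w n) =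
      n * (φ (y + (1 / (n : ℝ)) • w n) - φ y - 1 / (n : ℝ) * L (w n)) := by
    field_simp
  rw [dist_zero_right, heq, norm_mul, Real.norm_of_nonneg hn0.le]
  calc _ ≤ (n : ℝ) * (ε / (R + 1) * (1 / n * ‖w n‖)) := by gcongr
    _ = ε / (R + 1) * ‖w n‖ := by field_simp
    _ < ε / (R + 1) * (R + 1) := by
      gcongr
      linarith [hw n]
    _ = ε := by field_simp

/-- With `Y` of Rajchman law, `Y_n` its rounding to the nearest
`1/n`-graduation and `φ ∈ C¹ ∩ Lip`, the pair `(X, n(φ(Y_n) − φ(Y)))` converges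
in law to `(X, Σᵢ Vᵢ ∂ᵢφ(Y))`, the `Vᵢ` i.i.d. uniform on `(−1/2,1/2)` independent
of `(X,Y)`. -/
theorem stmt5 {Ω : Type*} [MeasurableSpace Ω] (P : Measure Ω) [IsProbabilityMeasure P]
    {d m : ℕ} (Y : Ω → (Fin d → ℝ)) (X : Ω → (Fin m → ℝ))
    (hY : Measurable Y) (hX : Measurable X)
    (hRaj : Tendsto (fun u : Fin d → ℝ =>
        ∫ ω, Complex.exp (Complex.I * (∑ i, u i * Y ω i)) ∂P)
      (cocompact (Fin d → ℝ)) (nhds 0))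
    (Yn : ℕ → Ω → (Fin d → ℝ))
    (hYn : ∀ n ω, Yn n ω = Y ω + (1 / (n:ℝ)) • roundTheta ((n:ℝ) • Y ω))
    (φ : (Fin d → ℝ) → ℝ) (hφ : ContDiff ℝ 1 φ) (K : NNReal) (hLip : LipschitzWith K φ) :
    ∀ F : BoundedContinuousFunction ((Fin m → ℝ) × ℝ) ℝ,
      Tendsto (fun n : ℕ => ∫ ω, F (X ω, (n:ℝ) * (φ (Yn n ω) - φ (Y ω))) ∂P)
        atTop
        (nhds (∫ ω, (∫ v in Set.univ.pi fun _ : Fin d => Set.Ioo (-(1/2) : ℝ) (1/2),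
          F (X ω, ∑ i, v i * fderiv ℝ φ (Y ω) (Pi.single i 1))) ∂P)) := by
  intro F
  have hgrad (y v : Fin d → ℝ) :
      ∑ i, v i * fderiv ℝ φ y (Pi.single i 1) = fderiv ℝ φ y v := by
    conv_rhs => rw [pi_eq_sum_univ' v]
    simp [map_sum]
  have hF (p : (Fin m → ℝ) × ℝ) : |F p| ≤ ‖F‖ := F.norm_coe_le_norm p
  have hW : Measurable fun ω =>
      (X ω, fun i : Fin d => fderiv ℝ φ (Y ω) (Pi.single i 1)) := by
    refine hX.prodMk (measurable_pi_lambda _ fun i => ?_)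
    exact ((hφ.continuous_fderiv one_ne_zero).clm_apply continuous_const).measurable.comp hY
  have hlin := tendsto_integral_comp_roundTheta hY hRaj hW
    (h := fun p => F (p.1.1, ∑ i, p.2 i * p.1.2 i)) (by fun_prop) (fun p => hF _)
  have hθ (n : ℕ) : Measurable fun ω => roundTheta ((n : ℝ) • Y ω) :=
    measurable_roundTheta.comp (hY.const_smul (n : ℝ))
  have hmeas (n : ℕ) : AEStronglyMeasurable
      (fun ω => F (X ω, (n : ℝ) * (φ (Yn n ω) - φ (Y ω)))) P := by
    have hYn' : Measurable (Yn n) := by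
      rw [funext (hYn n)]
      exact hY.add ((hθ n).const_smul (1 / (n : ℝ)))
    have hc := hφ.continuous.measurable
    exact (F.continuous.measurable.comp (hX.prodMk
      (((hc.comp hYn').sub (hc.comp hY)).const_mul _))).aestronglyMeasurable
  have hmeas' (n : ℕ) : AEStronglyMeasurable (fun ω => F (X ω,
      ∑ i, roundTheta ((n : ℝ) • Y ω) i * fderiv ℝ φ (Y ω) (Pi.single i 1))) P := by
    refine (F.continuous.measurable.comp (hX.prodMk
      (Finset.measurable_sum _ fun i _ => ?_))).aestronglyMeasurable
    exact ((measurable_pi_apply i).comp (hθ n)).mul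
      (((measurable_pi_apply i).comp (measurable_snd.comp hW)))
  have hdiff : Tendsto (fun n : ℕ => ∫ ω, (F (X ω, (n : ℝ) * (φ (Yn n ω) - φ (Y ω))) -
      F (X ω, ∑ i, roundTheta ((n : ℝ) • Y ω) i * fderiv ℝ φ (Y ω) (Pi.single i 1))) ∂P)
      atTop (𝓝 0) := by
    rw [← integral_zero Ω ℝ (μ := P)]
    refine tendsto_integral_of_dominated_convergence (fun _ => ‖F‖ + ‖F‖)
      (fun n => (hmeas n).sub (hmeas' n)) (integrable_const _)
      (fun n => ae_of_all _ fun ω => (norm_sub_le _ _).trans (add_le_add (hF _) (hF _)))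
      (ae_of_all _ fun ω => ?_)
    simp only [hgrad, hYn]
    refine tendsto_sub_comp_of_tendsto_sub (g := fun t => F (X ω, t)) (by fun_prop)
      (R := ‖fderiv ℝ φ (Y ω)‖ * 1)
      (fun n => (fderiv ℝ φ (Y ω)).le_opNorm_of_le (norm_roundTheta_le_one _)) ?_
    exact (hφ.differentiable one_ne_zero (Y ω)).hasFDerivAt.tendsto_nat_mul_sub_sub
      fun n => norm_roundTheta_le_one _
  have hsum := hdiff.add hlin
  rw [zero_add] at hsum
  refine hsum.congr fun n => ?_
  rw [integral_sub (Integrable.of_bound (hmeas n) ‖F‖ (ae_of_all _ fun ω => hF _))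
    (Integrable.of_bound (hmeas' n) ‖F‖ (ae_of_all _ fun ω => hF _)), sub_add_cancel]
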